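/- arXiv:1811.07133 — 2 statements merged into one kernel-verified Lean document; each statement's English description precedes it below -/
import Mathlib

section
/- For each n ≥ 2, let A_{n,1}, …, A_{n,n} be exchangeable events on a probability space and set Y_n := Σ_{j=1}^n 1{A_{n,j}}. If for some ν ∈ (0,∞) one has lim_{n→∞} n^k · P(A_{n,1} ∩ … ∩ A_{n,k}) = ν^k for every integer k ≥ 1, then Y_n converges in distribution, as n → ∞, to a Poisson distribution with parameter ν. -/
open MeasureTheory ProbabilityTheory Filter

/-- Bonferroni inequality for the truncated alternating sum of a row of Pascal's triangle. -/
lemma abs_ite_eq_zero_sub_alternating_sum_choose_le (N R : ℕ) :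
    |(if N = 0 then (1 : ℝ) else 0) - ∑ r ∈ Finset.range R, (-1 : ℝ) ^ r * N.choose r| ≤
      N.choose R := by
  rcases R with _ | R
  · simp only [Finset.range_zero, Finset.sum_empty, sub_zero, Nat.choose_zero_right, Nat.cast_one]
    split_ifs <;> simp
  rcases N with _ | N
  · simp [Finset.sum_range_succ']
  have h : ∑ r ∈ Finset.range (R + 1), (-1 : ℝ) ^ r * (N + 1).choose r =
      (-1) ^ R * N.choose R := by
    exact_mod_cast Int.alternating_sum_range_choose_eq_choose (n := N) (m := R)
  rw [h, Nat.choose_succ_succ]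
  simp [abs_mul]

/-- Bonferroni inequality for the indicator of `y = m` in terms of binomial moments of `y`. -/
lemma abs_ite_eq_sub_alternating_sum_choose_le (y m R : ℕ) :
    |(if y = m then (1 : ℝ) else 0) -
        ∑ r ∈ Finset.range R, (-1 : ℝ) ^ r * (m + r).choose m * y.choose (m + r)| ≤
      (m + R).choose m * y.choose (m + R) := by
  have hmul (r : ℕ) : ((m + r).choose m : ℝ) * y.choose (m + r) =
      y.choose m * (y - m).choose r := by
    have h := Nat.choose_mul (n := y) (Nat.le_add_right m r)
    rw [Nat.add_sub_cancel_left] at h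
    rw [mul_comm]
    exact_mod_cast h
  have hite : (if y = m then (1 : ℝ) else 0) = y.choose m * if y - m = 0 then 1 else 0 := by
    rcases lt_trichotomy y m with h | rfl | h
    · simp [h.ne, Nat.choose_eq_zero_of_lt h]
    · simp
    · simp [h.ne', (Nat.sub_pos_of_lt h).ne']
  have hsum : ∑ r ∈ Finset.range R, (-1 : ℝ) ^ r * (m + r).choose m * y.choose (m + r) =
      y.choose m * ∑ r ∈ Finset.range R, (-1 : ℝ) ^ r * (y - m).choose r := by
    rw [Finset.mul_sum]
    refine Finset.sum_congr rfl fun r _ => ?_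
    rw [mul_assoc, hmul]
    ring
  rw [hsum, hite, hmul, ← mul_sub, abs_mul, Nat.abs_cast]
  exact mul_le_mul_of_nonneg_left (abs_ite_eq_zero_sub_alternating_sum_choose_le _ _)
    (Nat.cast_nonneg _)

/-- A sequence converges to `L` if it has approximations, with error bounds, whose limits tend
to `L` and whose limiting errors tend to `0`. -/
lemma tendsto_of_forall_abs_sub_le {ι : Type*} {l : Filter ι} {a : ι → ℝ} {s e : ℕ → ι → ℝ}
    {S E : ℕ → ℝ} {L : ℝ} (h : ∀ R i, |a i - s R i| ≤ e R i)
    (hs : ∀ R, Tendsto (s R) l (nhds (S R))) (he : ∀ R, Tendsto (e R) l (nhds (E R)))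
    (hS : Tendsto S atTop (nhds L)) (hE : Tendsto E atTop (nhds 0)) :
    Tendsto a l (nhds L) := by
  rw [tendsto_order]
  constructor
  · intro b hb
    have hSE : Tendsto (fun R => S R - E R) atTop (nhds L) := by simpa using hS.sub hE
    obtain ⟨R, hR⟩ := (hSE.eventually_const_lt hb).exists
    filter_upwards [((hs R).sub (he R)).eventually_const_lt hR] with i hi
    linarith [(abs_le.1 (h R i)).1]
  · intro b hb
    have hSE : Tendsto (fun R => S R + E R) atTop (nhds L) := by simpa using hS.add hE
    obtain ⟨R, hR⟩ := (hSE.eventually_lt_const hb).exists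
    filter_upwards [((hs R).add (he R)).eventually_lt_const hR] with i hi
    linarith [(abs_le.1 (h R i)).2]

/-- The number of `k`-element subfamilies of events that occur jointly is a binomial
coefficient of the number of events that occur. -/
lemma choose_sum_indicator_eq {Ω ι : Type*} (s : Finset ι) (B : ι → Set Ω) (k : ℕ) (ω : Ω) :
    ((∑ j ∈ s, (B j).indicator (fun _ => (1 : ℕ)) ω).choose k : ℝ) =
      ∑ t ∈ s.powersetCard k, (⋂ j ∈ t, B j).indicator (fun _ => (1 : ℝ)) ω := by
  classical
  have hY : ∑ j ∈ s, (B j).indicator (fun _ => (1 : ℕ)) ω = (s.filter (ω ∈ B ·)).card := by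
    simp [Set.indicator_apply]
  have hfilter : (s.filter (ω ∈ B ·)).powersetCard k =
      (s.powersetCard k).filter (fun t => ω ∈ ⋂ j ∈ t, B j) := by
    ext t
    simp only [Finset.mem_powersetCard, Finset.mem_filter, Finset.subset_iff, Set.mem_iInter]
    grind
  rw [hY, ← Finset.card_powersetCard, hfilter, Finset.card_filter]
  simp [Set.indicator_apply]

/-- Binomial moments of the number of events that occur. -/
lemma integrable_and_integral_choose_sum_indicator {Ω ι : Type*} [MeasurableSpace Ω]
    (P : Measure Ω) [IsFiniteMeasure P] (s : Finset ι) {B : ι → Set Ω}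
    (hB : ∀ j, MeasurableSet (B j)) (k : ℕ) :
    Integrable (fun ω => ((∑ j ∈ s, (B j).indicator (fun _ => (1 : ℕ)) ω).choose k : ℝ)) P ∧
      ∫ ω, ((∑ j ∈ s, (B j).indicator (fun _ => (1 : ℕ)) ω).choose k : ℝ) ∂P =
        ∑ t ∈ s.powersetCard k, P.real (⋂ j ∈ t, B j) := by
  have hmeas (t : Finset ι) : MeasurableSet (⋂ j ∈ t, B j) :=
    t.measurableSet_biInter fun j _ => hB j
  have hint (t : Finset ι) : Integrable ((⋂ j ∈ t, B j).indicator fun _ => (1 : ℝ)) P :=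
    (integrable_const 1).indicator (hmeas t)
  simp_rw [choose_sum_indicator_eq]
  refine ⟨integrable_finsetSum _ fun t _ => hint t, ?_⟩
  rw [integral_finsetSum _ fun t _ => hint t]
  refine Finset.sum_congr rfl fun t _ => ?_
  simp [integral_indicator_const _ (hmeas t)]

/-- Bonferroni inequality for the probability that a natural-number-valued random variable with
finite binomial moments takes the value `m`. -/
lemma abs_measureReal_eq_sub_alternating_sum_integral_choose_le {Ω : Type*} [MeasurableSpace Ω]
    (P : Measure Ω) [IsFiniteMeasure P] {Y : Ω → ℕ} (hY : Measurable Y)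
    (hint : ∀ k, Integrable (fun ω => ((Y ω).choose k : ℝ)) P) (m R : ℕ) :
    |P.real {ω | Y ω = m} - ∑ r ∈ Finset.range R,
        (-1 : ℝ) ^ r * (m + r).choose m * ∫ ω, ((Y ω).choose (m + r) : ℝ) ∂P| ≤
      (m + R).choose m * ∫ ω, ((Y ω).choose (m + R) : ℝ) ∂P := by
  have hset : MeasurableSet {ω | Y ω = m} := hY (measurableSet_singleton m)
  have hind : (fun ω => if Y ω = m then (1 : ℝ) else 0) =
      {ω | Y ω = m}.indicator fun _ => 1 := by
    ext ω
    simp [Set.indicator_apply]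
  have hite : Integrable (fun ω => if Y ω = m then (1 : ℝ) else 0) P := by
    rw [hind]
    exact (integrable_const 1).indicator hset
  have hterm (r : ℕ) : Integrable
      (fun ω => (-1 : ℝ) ^ r * (m + r).choose m * ((Y ω).choose (m + r) : ℝ)) P :=
    (hint _).const_mul _
  have hP : P.real {ω | Y ω = m} = ∫ ω, (if Y ω = m then (1 : ℝ) else 0) ∂P := by
    rw [hind, integral_indicator_const _ hset]
    simp
  simp_rw [hP, ← integral_const_mul]
  rw [← integral_finsetSum _ fun r _ => hterm r,
    ← integral_sub hite (integrable_finsetSum _ fun r _ => hterm r)]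
  refine abs_integral_le_integral_abs.trans (integral_mono_of_nonneg ?_ ?_ ?_)
  · exact Eventually.of_forall fun ω => abs_nonneg _
  · exact (hint _).const_mul _
  · exact Eventually.of_forall fun ω => abs_ite_eq_sub_alternating_sum_choose_le (Y ω) m R

/-- Method of moments for the Poisson distribution, in terms of binomial moments. -/
lemma tendsto_measureReal_eq_poisson_of_tendsto_integral_choose {Ω : Type*} [MeasurableSpace Ω]
    (P : Measure Ω) [IsFiniteMeasure P] {Y : ℕ → Ω → ℕ} (hY : ∀ n, Measurable (Y n))
    (hint : ∀ n k, Integrable (fun ω => ((Y n ω).choose k : ℝ)) P) {ν : ℝ}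
    (hlim : ∀ k : ℕ, Tendsto (fun n => ∫ ω, ((Y n ω).choose k : ℝ) ∂P) atTop
      (nhds (ν ^ k / k.factorial))) (m : ℕ) :
    Tendsto (fun n => P.real {ω | Y n ω = m}) atTop
      (nhds (Real.exp (-ν) * ν ^ m / m.factorial)) := by
  have hchoose (r : ℕ) : ((m + r).choose m : ℝ) * (ν ^ (m + r) / (m + r).factorial) =
      ν ^ m / m.factorial * (ν ^ r / r.factorial) := by
    rw [Nat.cast_add_choose]
    field_simp [Nat.factorial_ne_zero]
    ring
  refine tendsto_of_forall_abs_sub_le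
    (fun R n => abs_measureReal_eq_sub_alternating_sum_integral_choose_le P (hY n) (hint n) m R)
    (fun R => tendsto_finsetSum _ fun r _ => (hlim (m + r)).const_mul _)
    (fun R => (hlim (m + R)).const_mul _) ?_ ?_
  · have hexp : HasSum (fun r : ℕ => (-ν) ^ r / r.factorial) (Real.exp (-ν)) := by
      rw [Real.exp_eq_exp_ℝ]
      exact NormedSpace.expSeries_div_hasSum_exp (-ν)
    convert! (hexp.mul_left (ν ^ m / m.factorial)).tendsto_sum_nat using 2
    · refine Finset.sum_congr rfl fun r _ => ?_
      rw [mul_assoc, hchoose, neg_pow ν]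
      ring
    · ring
  · simp_rw [hchoose]
    simpa using (FloorSemiring.tendsto_pow_div_factorial_atTop ν).const_mul (ν ^ m / m.factorial)

/-- Proposition 1 (Györfi–Henze–Walk): a Poisson limit theorem for sums of indicators
of exchangeable events. For each `n`, let `A n 0, …, A n (n-1)` be exchangeable events
(the probability of an intersection of `k` distinct events among them depends only on
`k`), and let `Y_n = Σ_{j<n} 1{A n j}`. If `n^k P(A_{n,1} ∩ … ∩ A_{n,k}) → ν^k` for all
`k ≥ 1` and some `ν ∈ (0,∞)`, then `Y_n` converges in distribution to `Po(ν)` (stated as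
pointwise convergence of the probability mass function, which for ℕ-valued random
variables is equivalent to convergence in distribution). -/
theorem exchangeable_poisson_limit {Ω : Type*} [MeasurableSpace Ω]
    (P : Measure Ω) [IsProbabilityMeasure P]
    (A : ℕ → ℕ → Set Ω)
    (hAmeas : ∀ n j, MeasurableSet (A n j))
    (hexch : ∀ n : ℕ, ∀ s t : Finset ℕ,
      s ⊆ Finset.range n → t ⊆ Finset.range n → s.card = t.card →
      P (⋂ j ∈ s, A n j) = P (⋂ j ∈ t, A n j))
    (ν : ℝ) (hν : 0 < ν)
    (hlim : ∀ k : ℕ, 1 ≤ k →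
      Filter.Tendsto
        (fun n : ℕ => (n : ℝ) ^ k * (P (⋂ j ∈ Finset.range k, A n j)).toReal)
        Filter.atTop (nhds (ν ^ k))) :
    ∀ m : ℕ,
      Filter.Tendsto
        (fun n : ℕ =>
          (P {ω | (∑ j ∈ Finset.range n, (A n j).indicator (fun _ => (1 : ℕ)) ω) = m}).toReal)
        Filter.atTop
        (nhds (Real.exp (-ν) * ν ^ m / m.factorial)) := by
  intro m
  have hmom (n k : ℕ) := integrable_and_integral_choose_sum_indicator P (Finset.range n)
    (hAmeas n) k
  refine tendsto_measureReal_eq_poisson_of_tendsto_integral_choose P (fun n => ?_)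
    (fun n k => (hmom n k).1) (fun k => ?_) m
  · exact Finset.measurable_sum _ fun j _ => measurable_const.indicator (hAmeas n j)
  have hlim' : Tendsto (fun n : ℕ => (n : ℝ) ^ k * P.real (⋂ j ∈ Finset.range k, A n j)) atTop
      (nhds (ν ^ k)) := by
    rcases Nat.eq_zero_or_pos k with rfl | hk
    · simp
    · exact hlim k hk
  have hequiv : Asymptotics.IsEquivalent atTop
      (fun n : ℕ => (n.choose k : ℝ) * P.real (⋂ j ∈ Finset.range k, A n j))
      (fun n : ℕ => (n : ℝ) ^ k / k.factorial * P.real (⋂ j ∈ Finset.range k, A n j)) :=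
    (isEquivalent_choose k).mul Asymptotics.IsEquivalent.refl
  have hchoose : Tendsto
      (fun n : ℕ => (n.choose k : ℝ) * P.real (⋂ j ∈ Finset.range k, A n j)) atTop
      (nhds (ν ^ k / k.factorial)) := by
    rw [hequiv.tendsto_nhds_iff]
    refine (hlim'.div_const _).congr fun n => ?_
    ring
  refine hchoose.congr' ?_
  filter_upwards [eventually_ge_atTop k] with n hn
  have hsum : ∀ t ∈ (Finset.range n).powersetCard k,
      P.real (⋂ j ∈ t, A n j) = P.real (⋂ j ∈ Finset.range k, A n j) := by
    intro t ht
    rw [Finset.mem_powersetCard] at ht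
    exact congrArg ENNReal.toReal (hexch n t (Finset.range k) ht.1
      (Finset.range_subset_range.2 hn) (by simp [ht.2]))
  rw [(hmom n k).2, Finset.sum_congr rfl hsum]
  simp
end

section
/- Let μ be a probability measure on ℝ with distribution function F, let x < z and r, s > 0 satisfy r + s ≥ z − x ≥ max{r, s}, and suppose μ(S(x,r)) = μ(S(z,s)) =: p > 0. If F is convex on S(x,r) ∪ S(z,s) (or, alternatively, concave on S(x,r) ∪ S(z,s)), then μ(S(x,r) ∩ S(z,s)) ≤ p/2, that is, μ(S(x,r) ∩ S(z,s))/μ(S(z,s)) ≤ 1/2. -/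
open MeasureTheory Metric

/-- The half-open interval `(a, b]` has measure `F b - F a`, where `F t = μ (-∞, t]`. -/
lemma measureReal_Ioc_eq_sub (μ : Measure ℝ) [IsFiniteMeasure μ] {a b : ℝ} (hab : a ≤ b) :
    μ.real (Set.Ioc a b) = μ.real (Set.Iic b) - μ.real (Set.Iic a) := by
  rw [← Set.Iic_sdiff_Iic, measureReal_sdiff (Set.Iic_subset_Iic.2 hab) measurableSet_Iic]

/-- A point of continuity of the distribution function carries no mass. -/
lemma measureReal_singleton_eq_zero_of_continuousAt (μ : Measure ℝ) [IsFiniteMeasure μ] {c : ℝ}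
    (hc : ContinuousAt (fun t => μ.real (Set.Iic t)) c) : μ.real {c} = 0 := by
  have hlim : Filter.Tendsto (fun t => μ.real (Set.Iic c) - μ.real (Set.Iic t))
      (nhdsWithin c (Set.Iio c)) (nhds 0) := by
    simpa using (hc.tendsto.mono_left nhdsWithin_le_nhds).const_sub (μ.real (Set.Iic c))
  refine le_antisymm (ge_of_tendsto hlim ?_) measureReal_nonneg
  filter_upwards [self_mem_nhdsWithin] with t (ht : t < c)
  rw [← measureReal_Ioc_eq_sub μ ht.le]
  exact measureReal_mono (by simpa using ht)

/-- Section 5 (Györfi–Henze–Walk), the case `d = 1`: if the distribution function `F` of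
`μ` is convex (or concave) on `S(x,r) ∪ S(z,s)`, where `x < z`, `r, s > 0`,
`r + s ≥ z − x ≥ max{r,s}` and `μ(S(x,r)) = μ(S(z,s)) = p > 0`, then
`μ(S(x,r) ∩ S(z,s)) ≤ p/2`, i.e. condition (7) holds with `β = 1/2`. -/
theorem intersection_bound_dim_one (μ : Measure ℝ) [IsProbabilityMeasure μ]
    (x z r s p : ℝ) (hxz : x < z) (hr : 0 < r) (hs : 0 < s)
    (hsum : z - x ≤ r + s) (hmax : max r s ≤ z - x)
    (hpx : (μ (closedBall x r)).toReal = p)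
    (hpz : (μ (closedBall z s)).toReal = p)
    (hp : 0 < p)
    (F : ℝ → ℝ) (hF : F = fun t => (μ (Set.Iic t)).toReal)
    (hconv : ConvexOn ℝ (closedBall x r ∪ closedBall z s) F ∨
      ConcaveOn ℝ (closedBall x r ∪ closedBall z s) F) :
    (μ (closedBall x r ∩ closedBall z s)).toReal ≤ p / 2 := by
  have hr_le : r ≤ z - x := (le_max_left r s).trans hmax
  have hs_le : s ≤ z - x := (le_max_right r s).trans hmax
  have hU : closedBall x r ∪ closedBall z s = Set.Icc (x - r) (z + s) := by
    rw [Real.closedBall_eq_Icc, Real.closedBall_eq_Icc,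
      Set.Icc_union_Icc' (by linarith) (by linarith), min_eq_left (by linarith),
      max_eq_right (by linarith)]
  have hI : closedBall x r ∩ closedBall z s = Set.Icc (z - s) (x + r) := by
    rw [Real.closedBall_eq_Icc, Real.closedBall_eq_Icc, Set.Icc_inter_Icc,
      sup_eq_right.2 (by linarith), inf_eq_left.2 (by linarith)]
  rw [Real.closedBall_eq_Icc] at hpx hpz
  rw [hI]
  rw [hU] at hconv
  change μ.real _ = p at hpx
  change μ.real _ = p at hpz
  change μ.real _ ≤ p / 2
  change F = fun t => μ.real (Set.Iic t) at hF
  have hFmono : Monotone F := by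
    rw [hF]
    exact fun a b hab => measureReal_mono (Set.Iic_subset_Iic.2 hab)
  have hIoc : ∀ {a b : ℝ}, a ≤ b → μ.real (Set.Ioc a b) = F b - F a := fun hab => by
    rw [hF]
    exact measureReal_Ioc_eq_sub μ hab
  have hcont : ContinuousAt F (z - s) := by
    have hint : ContinuousOn F (interior (Set.Icc (x - r) (z + s))) :=
      hconv.elim ConvexOn.continuousOn_interior ConcaveOn.continuousOn_interior
    rw [interior_Icc] at hint
    exact hint.continuousAt (Ioo_mem_nhds (by linarith) (by linarith))
  have hatom : μ.real {z - s} = 0 :=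
    measureReal_singleton_eq_zero_of_continuousAt μ (hF ▸ hcont)
  have hinter : μ.real (Set.Icc (z - s) (x + r)) ≤ F (x + r) - F (z - s) := by
    rw [← hIoc (by linarith), ← Set.Ioc_insert_left (by linarith), Set.insert_eq]
    exact (measureReal_union_le _ _).trans (by rw [hatom, zero_add])
  rcases hconv with h | h
  · have hu : z - s ∈ Set.Icc (x - r) (z + s) := ⟨by linarith, by linarith⟩
    have hv : 2 * (x + r) - (z - s) ∈ Set.Icc (x - r) (z + s) := ⟨by linarith, by linarith⟩
    have hmid := h.2 hu hv one_half_pos.le one_half_pos.le (add_halves 1)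
    simp only [smul_eq_mul] at hmid
    rw [show 1 / 2 * (z - s) + 1 / 2 * (2 * (x + r) - (z - s)) = x + r by ring] at hmid
    have hmono := hFmono (show 2 * (x + r) - (z - s) ≤ z + s by linarith)
    have hle : F (z + s) - F (z - s) ≤ p := by
      rw [← hIoc (by linarith), ← hpz]
      exact measureReal_mono Set.Ioc_subset_Icc_self
    linarith
  · have hu : 2 * (z - s) - (x + r) ∈ Set.Icc (x - r) (z + s) := ⟨by linarith, by linarith⟩
    have hv : x + r ∈ Set.Icc (x - r) (z + s) := ⟨by linarith, by linarith⟩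
    have hmid := h.2 hu hv one_half_pos.le one_half_pos.le (add_halves 1)
    simp only [smul_eq_mul] at hmid
    rw [show 1 / 2 * (2 * (z - s) - (x + r)) + 1 / 2 * (x + r) = z - s by ring] at hmid
    have hmono := hFmono (show x - r ≤ 2 * (z - s) - (x + r) by linarith)
    have hle : F (x + r) - F (x - r) ≤ p := by
      rw [← hIoc (by linarith), ← hpx]
      exact measureReal_mono Set.Ioc_subset_Icc_self
    linarith
end
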